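/- arXiv:0710.3667 — 7 statements merged into one kernel-verified Lean document; each statement's English description precedes it below -/
import Mathlib

section
/- Let Φ : W → W be in block form (A, π̃, σ̃). Then Φ∘Φ = −id if and only if the following three conditions hold: (i) A∘π̃ = π̃∘A*, where A* : V* → V* is the dual map of A (equivalently, β(A(π̃α)) = β(π̃(α∘A)) for all α, β); (ii) σ̃∘A = A*∘σ̃ (equivalently, (σ̃(AX))(Y) = (σ̃X)(AY) for all X, Y); (iii) A∘A = −id − π̃∘σ̃. -/
variable {V : Type*} [AddCommGroup V] [Module ℝ V] [FiniteDimensional ℝ V]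

/-- If `Φ : W → W` is in block form `(A, π̃, σ̃)`, then `Φ∘Φ = −id`
iff (i) `A∘π̃ = π̃∘A*`, (ii) `σ̃∘A = A*∘σ̃` and (iii) `A∘A = −id − π̃∘σ̃`. -/
theorem block_form_square_neg_id_iff
    (A : V →ₗ[ℝ] V) (pt : Module.Dual ℝ V →ₗ[ℝ] V)
    (st : V →ₗ[ℝ] Module.Dual ℝ V)
    (hpt : ∀ α β : Module.Dual ℝ V, β (pt α) = - α (pt β))
    (hst : ∀ X Y : V, st X Y = - st Y X)
    (Φ : (V × Module.Dual ℝ V) →ₗ[ℝ] (V × Module.Dual ℝ V))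
    (hΦ : ∀ (X : V) (α : Module.Dual ℝ V),
      Φ (X, α) = (A X + pt α, st X - α ∘ₗ A)) :
    Φ ∘ₗ Φ = -LinearMap.id ↔
      (A ∘ₗ pt = pt ∘ₗ A.dualMap ∧
       st ∘ₗ A = A.dualMap ∘ₗ st ∧
       A ∘ₗ A = -LinearMap.id - pt ∘ₗ st) := by
  constructor
  · intro h
    have key (X : V) (α : Module.Dual ℝ V) : Φ (Φ (X, α)) = -(X, α) := LinearMap.congr_fun h (X, α)
    simp only [hΦ, Prod.neg_mk, Prod.mk.injEq] at key
    refine ⟨?_, ?_, ?_⟩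
    · ext α
      have h₁ := (key 0 α).1
      simp only [map_zero, zero_add, zero_sub, map_neg, neg_zero] at h₁
      exact add_neg_eq_zero.mp h₁
    · ext X Y
      have h₂ := LinearMap.congr_fun (key X 0).2 Y
      simp only [map_zero, add_zero, LinearMap.zero_comp, sub_zero, neg_zero] at h₂
      exact sub_eq_zero.mp h₂
    · ext X
      have h₁ := (key X 0).1
      simp only [map_zero, add_zero, LinearMap.zero_comp, sub_zero] at h₁
      exact eq_sub_of_add_eq h₁
  · rintro ⟨h₁, h₂, h₃⟩
    refine LinearMap.ext fun ⟨X, α⟩ => ?_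
    have e₁ : A (pt α) = pt (α ∘ₗ A) := LinearMap.congr_fun h₁ α
    have e₂ : st (A X) = st X ∘ₗ A := LinearMap.congr_fun h₂ X
    have e₃ (Y : V) : A (A Y) = -Y - pt (st Y) := LinearMap.congr_fun h₃ Y
    simp only [LinearMap.comp_apply, LinearMap.neg_apply, LinearMap.id_apply, hΦ, Prod.neg_mk,
      Prod.mk.injEq]
    constructor
    · rw [map_add, map_sub, e₁, e₃]
      abel
    · ext Y
      have e₄ := hst (pt α) Y
      have e₅ := hpt α (st Y)
      simp only [map_add, e₂, LinearMap.add_apply, LinearMap.sub_apply, LinearMap.comp_apply,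
        LinearMap.neg_apply, e₃, map_sub, map_neg]
      linarith
end

section
/- Every generalized Riemannian metric ♯ on W arises from a unique pair (γ, ψ): there exist a unique inner product γ on V and a unique alternating bilinear form ψ on V such that ♯ equals the generalized Riemannian metric associated with the pair (γ, ψ), i.e. ♯(X,α) = (φX + ♯γα, ♭βX + α∘φ) with φ = −♯γ∘♭ψ and ♭β = ♭γ∘(id − φ∘φ). -/
variable {V : Type*} [AddCommGroup V] [Module ℝ V] [FiniteDimensional ℝ V]

/-- The neutral metric on the big tangent space `W = V × V*`. -/
noncomputable def neutralMetric (w w' : V × Module.Dual ℝ V) : ℝ :=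
  (1 / 2) * (w.2 w'.1 + w'.2 w.1)

/-- A generalized Riemannian metric on `W`: a linear map `♯ : W → W` such that
`♯∘♯ = id`, `g(♯w, ♯w') = g(w, w')`, and `G(w,w') := 2·g(♯w, w')` is a
symmetric positive-definite bilinear form. -/
def IsGenRiemMetric
    (S : (V × Module.Dual ℝ V) →ₗ[ℝ] (V × Module.Dual ℝ V)) : Prop :=
  S ∘ₗ S = LinearMap.id ∧
  (∀ w w', neutralMetric (S w) (S w') = neutralMetric w w') ∧
  (∀ w w', 2 * neutralMetric (S w) w' = 2 * neutralMetric (S w') w) ∧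
  (∀ w, w ≠ 0 → 0 < 2 * neutralMetric (S w) w)

/-- Every generalized Riemannian metric `♯` on `W` arises from a
unique pair `(γ, ψ)` of an inner product `γ` and an alternating bilinear form
`ψ` on `V`: `♯(X,α) = (φX + ♯γα, ♭βX + α∘φ)` with `φ = −♯γ∘♭ψ` and
`♭β = ♭γ∘(id − φ∘φ)`. -/
theorem genRiemMetric_unique_pair
    (S : (V × Module.Dual ℝ V) →ₗ[ℝ] (V × Module.Dual ℝ V))
    (hS : IsGenRiemMetric S) :
    ∃! p : (V →ₗ[ℝ] Module.Dual ℝ V) × (V →ₗ[ℝ] Module.Dual ℝ V),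
      (∀ X Y : V, p.1 X Y = p.1 Y X) ∧
      (∀ X : V, X ≠ 0 → 0 < p.1 X X) ∧
      (∀ X Y : V, p.2 X Y = - p.2 Y X) ∧
      ∃ sγ : Module.Dual ℝ V →ₗ[ℝ] V,
        sγ ∘ₗ p.1 = LinearMap.id ∧ p.1 ∘ₗ sγ = LinearMap.id ∧
        ∀ (X : V) (α : Module.Dual ℝ V),
          S (X, α) =
            ((-(sγ ∘ₗ p.2)) X + sγ α,
             (p.1 ∘ₗ (LinearMap.id - (-(sγ ∘ₗ p.2)) ∘ₗ (-(sγ ∘ₗ p.2)))) X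
               + α ∘ₗ (-(sγ ∘ₗ p.2))) := by
  obtain ⟨hinv, -, hsymm, hpos⟩ := hS
  simp only [neutralMetric] at hsymm hpos
  set A : V →ₗ[ℝ] V := LinearMap.fst ℝ _ _ ∘ₗ S ∘ₗ LinearMap.inl ℝ _ _
  set B : Module.Dual ℝ V →ₗ[ℝ] V := LinearMap.fst ℝ _ _ ∘ₗ S ∘ₗ LinearMap.inr ℝ _ _
  set C : V →ₗ[ℝ] Module.Dual ℝ V := LinearMap.snd ℝ _ _ ∘ₗ S ∘ₗ LinearMap.inl ℝ _ _
  have hSl (X : V) : S (X, 0) = (A X, C X) := rfl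
  have hSr (α : Module.Dual ℝ V) : S (0, α) = (B α, α ∘ₗ A) := by
    refine Prod.ext rfl (LinearMap.ext fun X => ?_)
    have h := hsymm (X, 0) (0, α)
    simp only [hSl, LinearMap.zero_apply, map_zero] at h
    simp only [LinearMap.comp_apply]
    linarith
  have hadd (X : V) (α : Module.Dual ℝ V) : S (X, α) = (A X + B α, C X + α ∘ₗ A) := by
    have h : ((X, α) : V × Module.Dual ℝ V) = (X, 0) + (0, α) := by simp
    rw [h, map_add, hSl, hSr, Prod.mk_add_mk]
  have hBsymm (α β : Module.Dual ℝ V) : α (B β) = β (B α) := by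
    have h := hsymm (0, α) (0, β)
    simp only [hSr, map_zero] at h
    linarith
  have hBpos (α : Module.Dual ℝ V) (hα : α ≠ 0) : 0 < α (B α) := by
    have h := hpos (0, α) (by simpa using hα)
    simp only [hSr, map_zero] at h
    linarith
  have hBinj : Function.Injective B := by
    refine (injective_iff_map_eq_zero B).2 fun α h => ?_
    by_contra hα
    simpa [h] using hBpos α hα
  have hAB (α : Module.Dual ℝ V) : A (B α) = -B (α ∘ₗ A) := by
    have h := congrArg Prod.fst (LinearMap.congr_fun hinv (0, α))
    simp only [LinearMap.comp_apply, hSr, hadd, LinearMap.id_apply] at h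
    exact eq_neg_of_add_eq_zero_left h
  have hBC (X : V) : B (C X) = X - A (A X) := by
    have h := congrArg Prod.fst (LinearMap.congr_fun hinv (X, 0))
    simp only [LinearMap.comp_apply, hSl, hadd, LinearMap.id_apply] at h
    exact eq_sub_of_add_eq' h
  let e : Module.Dual ℝ V ≃ₗ[ℝ] V :=
    LinearEquiv.ofInjectiveOfFinrankEq B hBinj Subspace.dual_finrank_eq
  have he (α : Module.Dual ℝ V) : e α = B α := rfl
  have heB (α : Module.Dual ℝ V) : e.symm (B α) = α := e.symm_apply_apply α
  have hBe (X : V) : B (e.symm X) = X := e.apply_symm_apply X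
  have hφ : -(B ∘ₗ (-(e.symm.toLinearMap ∘ₗ A))) = A := by
    ext X
    simp [hBe]
  refine ⟨(e.symm.toLinearMap, -(e.symm.toLinearMap ∘ₗ A)), ⟨?_, ?_, ?_, B, ?_, ?_, ?_⟩, ?_⟩
  · intro X Y
    obtain ⟨α, rfl⟩ := e.surjective X
    obtain ⟨β, rfl⟩ := e.surjective Y
    simpa [he, heB] using hBsymm α β
  · intro X hX
    obtain ⟨α, rfl⟩ := e.surjective X
    simpa [he, heB] using hBpos α (by simpa using hX)
  · intro X Y
    obtain ⟨α, rfl⟩ := e.surjective X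
    obtain ⟨β, rfl⟩ := e.surjective Y
    have h : α (A (B β)) = -β (A (B α)) := by
      rw [hAB β, map_neg, hBsymm, LinearMap.comp_apply]
    simp only [he, LinearMap.neg_apply, LinearMap.comp_apply, LinearEquiv.coe_coe, hAB, map_neg,
      heB, neg_neg]
    simpa [hAB] using h
  · ext X
    simp [hBe]
  · ext1 α
    simp [heB]
  · intro X α
    rw [hφ, hadd]
    refine Prod.ext rfl (congrArg (· + α ∘ₗ A) (hBinj ?_))
    simp [hBC, hBe]
  · rintro ⟨γ, ψ⟩ ⟨-, -, -, s, hsγ, hγs, h⟩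
    have hs : s = B := LinearMap.ext fun α => by
      have := congrArg Prod.fst (h 0 α)
      simpa [hSr] using this.symm
    subst hs
    have hφ' (X : V) : B (ψ X) = -A X := by
      have := congrArg Prod.fst (h X 0)
      simp only [hSl, map_zero, add_zero, LinearMap.neg_apply, LinearMap.comp_apply] at this
      rw [this, neg_neg]
    refine Prod.ext (LinearMap.ext fun X => hBinj ?_) (LinearMap.ext fun X => hBinj ?_)
    · simpa [hBe] using LinearMap.congr_fun hsγ X
    · simp [hBe, hφ']
end

section
/- For every inner product γ on V and every alternating bilinear form ψ on V, the map ♯(X,α) = (φX + ♯γα, ♭βX + α∘φ), with φ = −♯γ∘♭ψ and ♭β = ♭γ∘(id − φ∘φ), is a generalized Riemannian metric on W: it satisfies ♯∘♯ = id, g(♯w, ♯w') = g(w, w') for all w, w' ∈ W, and G(w,w') := 2·g(♯w, w') is a symmetric positive-definite bilinear form on W. -/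
variable {V : Type*} [AddCommGroup V] [Module ℝ V] [FiniteDimensional ℝ V]

theorem neutralMetric_comm (w w' : V × Module.Dual ℝ V) :
    neutralMetric w w' = neutralMetric w' w := by
  simp only [neutralMetric, add_comm]

/-- The endomorphism `φ = -♯γ ∘ ♭ψ` is skew-adjoint with respect to `γ`. -/
theorem apply_neg_sharp_comp_flat (γ ψ : V →ₗ[ℝ] Module.Dual ℝ V)
    (hγ : ∀ X Y : V, γ X Y = γ Y X) (hψ : ∀ X Y : V, ψ X Y = - ψ Y X)
    (s : Module.Dual ℝ V →ₗ[ℝ] V) (hs : γ ∘ₗ s = LinearMap.id) (X Y : V) :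
    γ X ((-(s ∘ₗ ψ)) Y) = -γ ((-(s ∘ₗ ψ)) X) Y := by
  have flat_apply (Z U : V) : γ ((-(s ∘ₗ ψ)) Z) U = -ψ Z U := by
    have := LinearMap.congr_fun (LinearMap.congr_fun hs (ψ Z)) U
    simpa using this
  rw [hγ, flat_apply, flat_apply, hψ Y X]

/-- Under the identification of covectors with vectors by `γ`, the metric `2 g(♯w, w')` is
`γ(X, Y) + γ(φX + a, φY + b)`. -/
theorem two_mul_neutralMetric_flat (γ : V →ₗ[ℝ] Module.Dual ℝ V) (φ : V →ₗ[ℝ] V)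
    (hγ : ∀ X Y : V, γ X Y = γ Y X) (hφ : ∀ X Y : V, γ X (φ Y) = -γ (φ X) Y)
    (X a Y b : V) :
    2 * neutralMetric (φ X + a, γ (X - φ (φ X + a))) (Y, γ b) =
      γ X Y + γ (φ X + a) (φ Y + b) := by
  have h := hφ (φ X + a) Y
  have hb := hγ b (φ X + a)
  simp only [neutralMetric, map_sub, map_add, LinearMap.sub_apply, LinearMap.add_apply] at *
  linarith

/-- For every inner product `γ` and every alternating bilinear
form `ψ` on `V`, the map `♯(X,α) = (φX + ♯γα, ♭βX + α∘φ)`, with `φ = −♯γ∘♭ψ`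
and `♭β = ♭γ∘(id − φ∘φ)`, is a generalized Riemannian metric on `W`: it
satisfies `♯∘♯ = id`, `g(♯w,♯w') = g(w,w')`, and `G(w,w') := 2·g(♯w,w')` is a
symmetric positive-definite bilinear form on `W`. -/
theorem assoc_sharp_is_genRiemMetric
    (γ ψ : V →ₗ[ℝ] Module.Dual ℝ V)
    (hγsymm : ∀ X Y : V, γ X Y = γ Y X)
    (hγpos : ∀ X : V, X ≠ 0 → 0 < γ X X)
    (hψalt : ∀ X Y : V, ψ X Y = - ψ Y X)
    (sγ : Module.Dual ℝ V →ₗ[ℝ] V)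
    (hsγ₁ : sγ ∘ₗ γ = LinearMap.id) (hsγ₂ : γ ∘ₗ sγ = LinearMap.id)
    (S : (V × Module.Dual ℝ V) →ₗ[ℝ] (V × Module.Dual ℝ V))
    (hS : ∀ (X : V) (α : Module.Dual ℝ V),
      S (X, α) =
        ((-(sγ ∘ₗ ψ)) X + sγ α,
         (γ ∘ₗ (LinearMap.id - (-(sγ ∘ₗ ψ)) ∘ₗ (-(sγ ∘ₗ ψ)))) X
           + α ∘ₗ (-(sγ ∘ₗ ψ)))) :
    S ∘ₗ S = LinearMap.id ∧
    (∀ w w', neutralMetric (S w) (S w') = neutralMetric w w') ∧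
    (∀ w w', 2 * neutralMetric (S w) w' = 2 * neutralMetric (S w') w) ∧
    (∀ w, w ≠ 0 → 0 < 2 * neutralMetric (S w) w) := by
  set φ : V →ₗ[ℝ] V := -(sγ ∘ₗ ψ)
  have hφ (X Y : V) : γ X (φ Y) = -γ (φ X) Y :=
    apply_neg_sharp_comp_flat γ ψ hγsymm hψalt sγ hsγ₂ X Y
  have sharp_flat (a : V) : sγ (γ a) = a := LinearMap.congr_fun hsγ₁ a
  have flat_surj (w : V × Module.Dual ℝ V) : ∃ X a : V, w = (X, γ a) :=
    ⟨w.1, sγ w.2, Prod.ext rfl (LinearMap.congr_fun hsγ₂ w.2).symm⟩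
  have S_flat (X a : V) : S (X, γ a) = (φ X + a, γ (X - φ (φ X + a))) := by
    rw [hS, sharp_flat]
    refine Prod.ext rfl (LinearMap.ext fun Y => ?_)
    have h := hφ a Y
    simp only [LinearMap.comp_apply, LinearMap.sub_apply, LinearMap.add_apply,
      LinearMap.id_apply, map_sub, map_add]
    linarith
  have S_S (w : V × Module.Dual ℝ V) : S (S w) = w := by
    obtain ⟨X, a, rfl⟩ := flat_surj w
    rw [S_flat, S_flat]
    simp
  have S_symm (w w' : V × Module.Dual ℝ V) :
      2 * neutralMetric (S w) w' = 2 * neutralMetric (S w') w := by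
    obtain ⟨X, a, rfl⟩ := flat_surj w
    obtain ⟨Y, b, rfl⟩ := flat_surj w'
    rw [S_flat, S_flat, two_mul_neutralMetric_flat γ φ hγsymm hφ,
      two_mul_neutralMetric_flat γ φ hγsymm hφ, hγsymm X, hγsymm (φ X + a)]
  refine ⟨LinearMap.ext S_S, fun w w' => ?_, S_symm, fun w hw => ?_⟩
  · have h := S_symm w (S w')
    rw [S_S, neutralMetric_comm w'] at h
    linarith
  · obtain ⟨X, a, rfl⟩ := flat_surj w
    rw [S_flat, two_mul_neutralMetric_flat γ φ hγsymm hφ]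
    have nonneg (Z : V) : 0 ≤ γ Z Z := by
      rcases eq_or_ne Z 0 with rfl | hZ
      · simp
      · exact (hγpos Z hZ).le
    rcases eq_or_ne X 0 with rfl | hX
    · have ha : a ≠ 0 := by
        rintro rfl
        simp at hw
      simpa using hγpos a ha
    · exact add_pos_of_pos_of_nonneg (hγpos X hX) (nonneg _)
end

section
/- Let (♯, Φ) be a generalized almost Hermitian structure on W. Then the complementary endomorphism Φᶜ := ♯∘Φ is a generalized almost complex structure on W, the pair (♯, Φᶜ) is again a generalized almost Hermitian structure, Φ∘Φᶜ = Φᶜ∘Φ, and ♯ = −Φ∘Φᶜ. -/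
variable {V : Type*} [AddCommGroup V] [Module ℝ V] [FiniteDimensional ℝ V]

/-- A generalized almost complex structure on `W`. -/
def IsGenAlmostComplex
    (Φ : (V × Module.Dual ℝ V) →ₗ[ℝ] (V × Module.Dual ℝ V)) : Prop :=
  Φ ∘ₗ Φ = -LinearMap.id ∧
  ∀ w w', neutralMetric (Φ w) w' + neutralMetric w (Φ w') = 0

/-- For a generalized almost Hermitian structure `(♯, Φ)`, the
complementary endomorphism `Φᶜ := ♯∘Φ` is a generalized almost complex
structure, `(♯, Φᶜ)` is again a generalized almost Hermitian structure,
`Φ∘Φᶜ = Φᶜ∘Φ`, and `♯ = −Φ∘Φᶜ`. -/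
theorem complementary_structure
    (S Φ : (V × Module.Dual ℝ V) →ₗ[ℝ] (V × Module.Dual ℝ V))
    (hS : IsGenRiemMetric S) (hΦ : IsGenAlmostComplex Φ)
    (hcomm : S ∘ₗ Φ = Φ ∘ₗ S) :
    IsGenAlmostComplex (S ∘ₗ Φ) ∧
    S ∘ₗ (S ∘ₗ Φ) = (S ∘ₗ Φ) ∘ₗ S ∧
    Φ ∘ₗ (S ∘ₗ Φ) = (S ∘ₗ Φ) ∘ₗ Φ ∧
    S = -(Φ ∘ₗ (S ∘ₗ Φ)) := by
  obtain ⟨hSS, hSg, -, -⟩ := hS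
  obtain ⟨hΦΦ, hΦg⟩ := hΦ
  have hSS' (w) : S (S w) = w := LinearMap.congr_fun hSS w
  have hΦΦ' (w) : Φ (Φ w) = -w := LinearMap.congr_fun hΦΦ w
  have hc (w) : S (Φ w) = Φ (S w) := LinearMap.congr_fun hcomm w
  refine ⟨⟨LinearMap.ext fun w => ?_, fun w w' => ?_⟩, LinearMap.ext fun w => ?_,
    LinearMap.ext fun w => ?_, LinearMap.ext fun w => ?_⟩
  · simp only [LinearMap.comp_apply, LinearMap.neg_apply, LinearMap.id_apply]
    rw [← hc, hSS', hΦΦ']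
  · rw [LinearMap.comp_apply, LinearMap.comp_apply, ← hSg (S (Φ w)) w', hSS', hc w']
    exact hΦg w (S w')
  · simp only [LinearMap.comp_apply, hc]
  · simp only [LinearMap.comp_apply, hc]
  · simp only [LinearMap.comp_apply, LinearMap.neg_apply]
    rw [← hc, hΦΦ', map_neg, neg_neg]
end

section
/- Let (♯, Φ) be a generalized almost Hermitian structure on W, where ♯ is the generalized Riemannian metric associated with the pair (γ, ψ) and Φ is in block form (A, π̃, σ̃). Define J± := A + π̃∘(♭ψ ± ♭γ) : V → V. Then J±∘J± = −id and γ(J±X, J±Y) = γ(X, Y) for all X, Y ∈ V; that is, (γ, J+) and (γ, J−) are two classical almost Hermitian structures on V. -/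
variable {V : Type*} [AddCommGroup V] [Module ℝ V] [FiniteDimensional ℝ V]

/-- If `(X, (ψ + εγ)X)` is an `ε`-eigenvector of `S` for all `X`, and every `ε`-eigenvector has this
form, then an endomorphism `Φ` in block form commuting with `S` and squaring to `-1` induces on `V`
a complex structure compatible with `γ`. -/
theorem complexStructure_of_commutes_eigenspace
    {V : Type*} [AddCommGroup V] [Module ℝ V]
    (γ ψ : V →ₗ[ℝ] Module.Dual ℝ V)
    (hγsymm : ∀ X Y : V, γ X Y = γ Y X)
    (hψalt : ∀ X Y : V, ψ X Y = - ψ Y X)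
    (S : (V × Module.Dual ℝ V) →ₗ[ℝ] (V × Module.Dual ℝ V))
    (A : V →ₗ[ℝ] V) (pt : Module.Dual ℝ V →ₗ[ℝ] V)
    (st : V →ₗ[ℝ] Module.Dual ℝ V)
    (hpt : ∀ α β : Module.Dual ℝ V, β (pt α) = - α (pt β))
    (hst : ∀ X Y : V, st X Y = - st Y X)
    (Φ : (V × Module.Dual ℝ V) →ₗ[ℝ] (V × Module.Dual ℝ V))
    (hΦ : ∀ (X : V) (α : Module.Dual ℝ V),
      Φ (X, α) = (A X + pt α, st X - α ∘ₗ A))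
    (hΦ2 : Φ ∘ₗ Φ = -LinearMap.id)
    (hcomm : S ∘ₗ Φ = Φ ∘ₗ S)
    (ε : ℝ) (hε : ε ≠ 0) (E : V →ₗ[ℝ] Module.Dual ℝ V) (hE : E = ψ + ε • γ)
    (hS : ∀ (X : V) (α : Module.Dual ℝ V), S (X, α) = ε • (X, α) ↔ α = E X) :
    ((A + pt ∘ₗ E) ∘ₗ (A + pt ∘ₗ E) = -LinearMap.id) ∧
    (∀ X Y : V, γ ((A + pt ∘ₗ E) X) ((A + pt ∘ₗ E) Y) = γ X Y) := by
  set J := A + pt ∘ₗ E with hJ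
  have hJX (X : V) : J X = A X + pt (E X) := rfl
  have hβ (X : V) : st X - E X ∘ₗ A = E (J X) := by
    rw [← hS, hJX, ← hΦ, ← LinearMap.comp_apply, hcomm, LinearMap.comp_apply, (hS X _).2 rfl,
      map_smul]
  have hΦJ (X : V) : Φ (X, E X) = (J X, E (J X)) := by rw [hΦ, hβ, hJX]
  have hJ2 (X : V) : J (J X) = -X := by
    have h := LinearMap.congr_fun hΦ2 (X, E X)
    rw [LinearMap.comp_apply, hΦJ, hΦJ] at h
    exact congrArg Prod.fst h
  have hEsymm (X Y : V) : E X Y + E Y X = 2 * ε * γ X Y := by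
    simp only [hE, LinearMap.add_apply, LinearMap.smul_apply, smul_eq_mul]
    rw [hψalt X Y, hγsymm Y X]
    ring
  have hEJ (X Y : V) : E (J X) Y = st X Y - E X (A Y) := by
    rw [← hβ]; rfl
  have hskew (X Y : V) : γ (J X) Y = -γ (J Y) X := by
    have h₁ := hEsymm (J X) Y
    have h₂ := hEsymm (J Y) X
    rw [hEJ, hJX X, map_add, ← hJX] at h₁
    rw [hEJ, hJX Y, map_add, ← hJX] at h₂
    have h : 2 * ε * (γ (J X) Y + γ (J Y) X) = 0 := by
      linear_combination -h₁ - h₂ + hst X Y + hpt (E X) (E Y)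
    have h' := (mul_eq_zero.1 h).resolve_left (mul_ne_zero two_ne_zero hε)
    linarith
  refine ⟨LinearMap.ext hJ2, fun X Y => ?_⟩
  rw [hskew, hJ2, map_neg, LinearMap.neg_apply, neg_neg, hγsymm]

/-- The `ε`-eigenspace, `ε = ±1`, of the generalized Riemannian metric associated with `(γ, ψ)` is
the graph of `ψ + εγ`. -/
theorem generalizedMetric_apply_eq_smul_iff
    {V : Type*} [AddCommGroup V] [Module ℝ V]
    (γ ψ : V →ₗ[ℝ] Module.Dual ℝ V)
    (hγsymm : ∀ X Y : V, γ X Y = γ Y X)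
    (hψalt : ∀ X Y : V, ψ X Y = - ψ Y X)
    (sγ : Module.Dual ℝ V →ₗ[ℝ] V)
    (hsγ₁ : sγ ∘ₗ γ = LinearMap.id) (hsγ₂ : γ ∘ₗ sγ = LinearMap.id)
    (S : (V × Module.Dual ℝ V) →ₗ[ℝ] (V × Module.Dual ℝ V))
    (hS : ∀ (X : V) (α : Module.Dual ℝ V),
      S (X, α) =
        ((-(sγ ∘ₗ ψ)) X + sγ α,
         (γ ∘ₗ (LinearMap.id - (-(sγ ∘ₗ ψ)) ∘ₗ (-(sγ ∘ₗ ψ)))) X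
           + α ∘ₗ (-(sγ ∘ₗ ψ))))
    (ε : ℝ) (hε : ε * ε = 1) (X : V) (α : Module.Dual ℝ V) :
    S (X, α) = ε • (X, α) ↔ α = (ψ + ε • γ) X := by
  have hγs (α : Module.Dual ℝ V) : γ (sγ α) = α := LinearMap.congr_fun hsγ₂ α
  have hsγ (X : V) : sγ (γ X) = X := LinearMap.congr_fun hsγ₁ X
  rw [hS]
  constructor
  · intro h
    have h₁ : -sγ (ψ X) + sγ α = ε • X := congrArg Prod.fst h
    have h₂ := congrArg γ h₁
    rw [map_add, map_neg, hγs, hγs, map_smul] at h₂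
    rw [LinearMap.add_apply, LinearMap.smul_apply, ← h₂]
    abel
  · rintro rfl
    refine Prod.ext ?_ (LinearMap.ext fun Y => ?_)
    · simp [hsγ]
    · have h₁ : γ X (sγ (ψ Y)) = ψ Y X := by rw [hγsymm, hγs]
      have h₂ : ψ X (sγ (ψ Y)) = -ψ (sγ (ψ X)) Y := by
        rw [← hγs (ψ X), hγsymm, hγs, hψalt, hγs]
      simp [hγs, h₁, h₂]
      linear_combination (-ε) * hψalt X Y - γ X Y * hε

/-- Let `(♯, Φ)` be a generalized almost Hermitian structure on
`W`, with `♯` associated with the pair `(γ, ψ)` and `Φ` in block form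
`(A, π̃, σ̃)`. Define `J± := A + π̃∘(♭ψ ± ♭γ)`. Then `J±∘J± = −id` and
`γ(J±X, J±Y) = γ(X,Y)`, i.e. `(γ, J±)` are two classical almost Hermitian
structures on `V`. -/
theorem gen_almost_hermitian_gives_classical_pair
    (γ ψ : V →ₗ[ℝ] Module.Dual ℝ V)
    (hγsymm : ∀ X Y : V, γ X Y = γ Y X)
    (hγpos : ∀ X : V, X ≠ 0 → 0 < γ X X)
    (hψalt : ∀ X Y : V, ψ X Y = - ψ Y X)
    (sγ : Module.Dual ℝ V →ₗ[ℝ] V)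
    (hsγ₁ : sγ ∘ₗ γ = LinearMap.id) (hsγ₂ : γ ∘ₗ sγ = LinearMap.id)
    (S : (V × Module.Dual ℝ V) →ₗ[ℝ] (V × Module.Dual ℝ V))
    (hS : ∀ (X : V) (α : Module.Dual ℝ V),
      S (X, α) =
        ((-(sγ ∘ₗ ψ)) X + sγ α,
         (γ ∘ₗ (LinearMap.id - (-(sγ ∘ₗ ψ)) ∘ₗ (-(sγ ∘ₗ ψ)))) X
           + α ∘ₗ (-(sγ ∘ₗ ψ))))
    (A : V →ₗ[ℝ] V) (pt : Module.Dual ℝ V →ₗ[ℝ] V)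
    (st : V →ₗ[ℝ] Module.Dual ℝ V)
    (hpt : ∀ α β : Module.Dual ℝ V, β (pt α) = - α (pt β))
    (hst : ∀ X Y : V, st X Y = - st Y X)
    (Φ : (V × Module.Dual ℝ V) →ₗ[ℝ] (V × Module.Dual ℝ V))
    (hΦ : ∀ (X : V) (α : Module.Dual ℝ V),
      Φ (X, α) = (A X + pt α, st X - α ∘ₗ A))
    (hΦ2 : Φ ∘ₗ Φ = -LinearMap.id)
    (hcomm : S ∘ₗ Φ = Φ ∘ₗ S) :
    ((A + pt ∘ₗ (ψ + γ)) ∘ₗ (A + pt ∘ₗ (ψ + γ)) = -LinearMap.id) ∧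
    ((A + pt ∘ₗ (ψ - γ)) ∘ₗ (A + pt ∘ₗ (ψ - γ)) = -LinearMap.id) ∧
    (∀ X Y : V, γ ((A + pt ∘ₗ (ψ + γ)) X) ((A + pt ∘ₗ (ψ + γ)) Y) = γ X Y) ∧
    (∀ X Y : V, γ ((A + pt ∘ₗ (ψ - γ)) X) ((A + pt ∘ₗ (ψ - γ)) Y) = γ X Y) := by
  have key (ε : ℝ) (hε : ε * ε = 1) :=
    complexStructure_of_commutes_eigenspace γ ψ hγsymm hψalt S A pt st hpt hst Φ hΦ hΦ2 hcomm ε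
      (left_ne_zero_of_mul_eq_one hε) (ψ + ε • γ) rfl
      (generalizedMetric_apply_eq_smul_iff γ ψ hγsymm hψalt sγ hsγ₁ hsγ₂ S hS ε hε)
  have hp := key 1 (by norm_num)
  have hm := key (-1) (by norm_num)
  rw [one_smul] at hp
  have hsub : ψ + (-1 : ℝ) • γ = ψ - γ := by
    ext X Y
    simp [sub_eq_add_neg]
  rw [hsub] at hm
  exact ⟨hp.1, hm.1, hp.2, hm.2⟩
end

section
/- If ♯ is the generalized Riemannian metric associated with the pair (γ, ψ), then for every t ∈ ℝ the conjugate ♯' = C_{−t}∘♯∘C_t is a generalized Riemannian metric on W, and it is the generalized Riemannian metric associated with the pair (e^{−t}·γ, e^{−t}·ψ). -/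
variable {V : Type*} [AddCommGroup V] [Module ℝ V] [FiniteDimensional ℝ V]

/-- The conformal change `C_t(X,α) = (X, e^t·α)` of `W = V × V*`. -/
noncomputable def conformalChange (t : ℝ) :
    (V × Module.Dual ℝ V) →ₗ[ℝ] (V × Module.Dual ℝ V) :=
  (LinearMap.id : V →ₗ[ℝ] V).prodMap
    (Real.exp t • (LinearMap.id : Module.Dual ℝ V →ₗ[ℝ] Module.Dual ℝ V))

/-- For `♯` associated with `(γ, ψ)`, with `φ = −♯γ∘♭ψ`, the form `G(w, w') = 2·g(♯w, w')` is
`γ(X, X') + γ(φX + ♯γα, φX' + ♯γα')`. -/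
theorem two_mul_neutralMetric_of_assoc
    {γ : V →ₗ[ℝ] Module.Dual ℝ V} {s : Module.Dual ℝ V →ₗ[ℝ] V} {φ : V →ₗ[ℝ] V}
    {S : (V × Module.Dual ℝ V) →ₗ[ℝ] (V × Module.Dual ℝ V)}
    (hγsymm : ∀ X Y : V, γ X Y = γ Y X) (hγs : ∀ α, γ (s α) = α)
    (hφskew : ∀ X Y : V, γ (φ X) Y = -γ X (φ Y))
    (hS : ∀ X α, S (X, α) = (φ X + s α, γ (X - φ (φ X)) + α ∘ₗ φ))
    (w w' : V × Module.Dual ℝ V) :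
    2 * neutralMetric (S w) w' =
      γ w.1 w'.1 + γ (φ w.1 + s w.2) (φ w'.1 + s w'.2) := by
  obtain ⟨X, α⟩ := w
  obtain ⟨Y, β⟩ := w'
  simp only [neutralMetric, hS, map_add, map_sub, LinearMap.add_apply, LinearMap.sub_apply,
    LinearMap.comp_apply, hγs, hφskew (φ X) Y]
  have hαβ : α (s β) = β (s α) := by rw [← hγs α, hγsymm, hγs, hγs]
  rw [hγsymm (φ X) (s β), hγs, hαβ]
  ring

/-- The map associated with a pair `(γ, ψ)` is an involution. -/
theorem comp_self_of_assoc
    {γ : V →ₗ[ℝ] Module.Dual ℝ V} {s : Module.Dual ℝ V →ₗ[ℝ] V} {φ : V →ₗ[ℝ] V}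
    {S : (V × Module.Dual ℝ V) →ₗ[ℝ] (V × Module.Dual ℝ V)}
    (hsγ : ∀ X, s (γ X) = X) (hγs : ∀ α, γ (s α) = α)
    (hφskew : ∀ X Y : V, γ (φ X) Y = -γ X (φ Y))
    (hS : ∀ X α, S (X, α) = (φ X + s α, γ (X - φ (φ X)) + α ∘ₗ φ)) :
    S ∘ₗ S = LinearMap.id := by
  have hγφ : ∀ X, γ X ∘ₗ φ = -γ (φ X) := fun X => by
    ext Y
    simp [hφskew]
  have key : ∀ X A, S (X, γ A) = (φ X + A, γ (X - φ (φ X) - φ A)) := fun X A => by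
    rw [hS, hsγ, hγφ, map_sub γ _ (φ A), sub_eq_add_neg (γ _)]
  refine LinearMap.ext fun ⟨X, α⟩ => ?_
  rw [LinearMap.comp_apply, ← hγs α, key, key]
  refine Prod.ext ?_ (congrArg γ ?_)
  · simp only [map_add, LinearMap.id_apply]
    abel
  · simp only [map_add, map_sub]
    abel

/-- The map associated with a pair `(γ, ψ)` is a generalized Riemannian metric. -/
theorem isGeneralizedRiemannian_of_assoc
    {γ ψ : V →ₗ[ℝ] Module.Dual ℝ V} {s : Module.Dual ℝ V →ₗ[ℝ] V}
    {S : (V × Module.Dual ℝ V) →ₗ[ℝ] (V × Module.Dual ℝ V)}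
    (hγsymm : ∀ X Y : V, γ X Y = γ Y X) (hγpos : ∀ X : V, X ≠ 0 → 0 < γ X X)
    (hψalt : ∀ X Y : V, ψ X Y = -ψ Y X)
    (hsγ : s ∘ₗ γ = LinearMap.id) (hγs : γ ∘ₗ s = LinearMap.id)
    (hS : ∀ (X : V) (α : Module.Dual ℝ V),
      S (X, α) =
        ((-(s ∘ₗ ψ)) X + s α,
         (γ ∘ₗ (LinearMap.id - (-(s ∘ₗ ψ)) ∘ₗ (-(s ∘ₗ ψ)))) X + α ∘ₗ (-(s ∘ₗ ψ)))) :
    S ∘ₗ S = LinearMap.id ∧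
    (∀ w w', neutralMetric (S w) (S w') = neutralMetric w w') ∧
    (∀ w w', 2 * neutralMetric (S w) w' = 2 * neutralMetric (S w') w) ∧
    (∀ w, w ≠ 0 → 0 < 2 * neutralMetric (S w) w) := by
  have hsγ' : ∀ X, s (γ X) = X := LinearMap.congr_fun hsγ
  have hγs' : ∀ α, γ (s α) = α := LinearMap.congr_fun hγs
  have hφskew : ∀ X Y : V, γ ((-(s ∘ₗ ψ)) X) Y = -γ X ((-(s ∘ₗ ψ)) Y) := fun X Y => by
    rw [hγsymm X]
    simp only [LinearMap.neg_apply, LinearMap.comp_apply, map_neg, hγs']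
    rw [hψalt X Y, neg_neg]
  have hG := two_mul_neutralMetric_of_assoc hγsymm hγs' hφskew hS
  have hinv := comp_self_of_assoc hsγ' hγs' hφskew hS
  have hsymm : ∀ w w', 2 * neutralMetric (S w) w' = 2 * neutralMetric (S w') w := fun w w' => by
    rw [hG, hG, hγsymm w.1, hγsymm (_ + _)]
  have hnonneg : ∀ X, 0 ≤ γ X X := fun X => by
    rcases eq_or_ne X 0 with rfl | hX
    · simp
    · exact (hγpos X hX).le
  refine ⟨hinv, fun w w' => ?_, hsymm, fun w hw => ?_⟩
  · have h := hsymm w (S w')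
    rw [← LinearMap.comp_apply S S, hinv, LinearMap.id_apply] at h
    simp only [neutralMetric] at h ⊢
    linarith
  · rw [hG]
    rcases eq_or_ne w.1 0 with h1 | h1
    · have h2 : s w.2 ≠ 0 := fun h2 => hw <| Prod.ext h1 <| by
        rw [← hγs' w.2, h2, map_zero, Prod.snd_zero]
      simpa [h1] using hγpos _ h2
    · exact add_pos_of_pos_of_nonneg (hγpos _ h1) (hnonneg _)

/-- If `♯` is the generalized Riemannian metric associated with
`(γ, ψ)`, then for every `t ∈ ℝ` the conjugate `♯' = C_{−t}∘♯∘C_t` is a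
generalized Riemannian metric on `W`, and it is the generalized Riemannian
metric associated with the pair `(e^{−t}·γ, e^{−t}·ψ)`. -/
theorem conjugate_of_assoc_metric
    (γ ψ : V →ₗ[ℝ] Module.Dual ℝ V)
    (hγsymm : ∀ X Y : V, γ X Y = γ Y X)
    (hγpos : ∀ X : V, X ≠ 0 → 0 < γ X X)
    (hψalt : ∀ X Y : V, ψ X Y = - ψ Y X)
    (sγ : Module.Dual ℝ V →ₗ[ℝ] V)
    (hsγ₁ : sγ ∘ₗ γ = LinearMap.id) (hsγ₂ : γ ∘ₗ sγ = LinearMap.id)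
    (S : (V × Module.Dual ℝ V) →ₗ[ℝ] (V × Module.Dual ℝ V))
    (hS : ∀ (X : V) (α : Module.Dual ℝ V),
      S (X, α) =
        ((-(sγ ∘ₗ ψ)) X + sγ α,
         (γ ∘ₗ (LinearMap.id - (-(sγ ∘ₗ ψ)) ∘ₗ (-(sγ ∘ₗ ψ)))) X
           + α ∘ₗ (-(sγ ∘ₗ ψ))))
    (t : ℝ) :
    ((conformalChange (-t) ∘ₗ S ∘ₗ conformalChange t) ∘ₗ
        (conformalChange (-t) ∘ₗ S ∘ₗ conformalChange t) = LinearMap.id) ∧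
    (∀ w w',
      neutralMetric ((conformalChange (-t) ∘ₗ S ∘ₗ conformalChange t) w)
          ((conformalChange (-t) ∘ₗ S ∘ₗ conformalChange t) w') =
        neutralMetric w w') ∧
    (∀ w w',
      2 * neutralMetric ((conformalChange (-t) ∘ₗ S ∘ₗ conformalChange t) w) w' =
        2 * neutralMetric ((conformalChange (-t) ∘ₗ S ∘ₗ conformalChange t) w') w) ∧
    (∀ w, w ≠ 0 →
      0 < 2 * neutralMetric ((conformalChange (-t) ∘ₗ S ∘ₗ conformalChange t) w) w) ∧
    (∃ sγ' : Module.Dual ℝ V →ₗ[ℝ] V,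
      sγ' ∘ₗ (Real.exp (-t) • γ) = LinearMap.id ∧
      (Real.exp (-t) • γ) ∘ₗ sγ' = LinearMap.id ∧
      ∀ (X : V) (α : Module.Dual ℝ V),
        (conformalChange (-t) ∘ₗ S ∘ₗ conformalChange t) (X, α) =
          ((-(sγ' ∘ₗ (Real.exp (-t) • ψ))) X + sγ' α,
           ((Real.exp (-t) • γ) ∘ₗ
              (LinearMap.id -
                (-(sγ' ∘ₗ (Real.exp (-t) • ψ))) ∘ₗ
                  (-(sγ' ∘ₗ (Real.exp (-t) • ψ))))) X
             + α ∘ₗ (-(sγ' ∘ₗ (Real.exp (-t) • ψ))))) := by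
  have hexp : Real.exp t * Real.exp (-t) = 1 := by rw [← Real.exp_add]; simp
  have hexp' : Real.exp (-t) * Real.exp t = 1 := by rw [mul_comm, hexp]
  have hs₁ : (Real.exp t • sγ) ∘ₗ (Real.exp (-t) • γ) = LinearMap.id := by
    rw [LinearMap.smul_comp, LinearMap.comp_smul, smul_smul, hexp, one_smul, hsγ₁]
  have hs₂ : (Real.exp (-t) • γ) ∘ₗ (Real.exp t • sγ) = LinearMap.id := by
    rw [LinearMap.smul_comp, LinearMap.comp_smul, smul_smul, hexp', one_smul, hsγ₂]
  have hφ : (Real.exp t • sγ) ∘ₗ (Real.exp (-t) • ψ) = sγ ∘ₗ ψ := by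
    rw [LinearMap.smul_comp, LinearMap.comp_smul, smul_smul, hexp, one_smul]
  have hconj : ∀ (X : V) (α : Module.Dual ℝ V),
      (conformalChange (-t) ∘ₗ S ∘ₗ conformalChange t) (X, α) =
        ((-((Real.exp t • sγ) ∘ₗ (Real.exp (-t) • ψ))) X + (Real.exp t • sγ) α,
         ((Real.exp (-t) • γ) ∘ₗ
            (LinearMap.id -
              (-((Real.exp t • sγ) ∘ₗ (Real.exp (-t) • ψ))) ∘ₗ
                (-((Real.exp t • sγ) ∘ₗ (Real.exp (-t) • ψ))))) X
           + α ∘ₗ (-((Real.exp t • sγ) ∘ₗ (Real.exp (-t) • ψ)))) := fun X α => by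
    have hC : ∀ (r : ℝ) (Y : V) (β : Module.Dual ℝ V),
        conformalChange r (Y, β) = (Y, Real.exp r • β) := fun _ _ _ => rfl
    rw [hφ, LinearMap.comp_apply, LinearMap.comp_apply, hC, hS, hC, map_smul, smul_add,
      LinearMap.smul_comp, LinearMap.smul_comp, smul_smul, hexp', one_smul,
      LinearMap.smul_apply, LinearMap.smul_apply]
  obtain ⟨hinv, hiso, hsymm, hpos⟩ := isGeneralizedRiemannian_of_assoc
    (fun X Y => by simp only [LinearMap.smul_apply, hγsymm X Y])
    (fun X hX => by
      simpa only [LinearMap.smul_apply, smul_eq_mul] using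
        mul_pos (Real.exp_pos (-t)) (hγpos X hX))
    (fun X Y => by simp only [LinearMap.smul_apply, hψalt X Y, smul_neg])
    hs₁ hs₂ hconj
  exact ⟨hinv, hiso, hsymm, hpos, Real.exp t • sγ, hs₁, hs₂, hconj⟩
end

section
/- Let V be a real vector space with dim V > 4, let ω be a nondegenerate alternating bilinear form on V, and let J : V → V be a linear map with J∘J = −id. If α ∈ V* is a linear functional such that the alternating 4-form obtained by antisymmetrizing the map (x₁,x₂,x₃,x₄) ↦ α(x₁)·α(Jx₂)·ω(x₃,x₄) (i.e. the wedge product α ∧ (α∘J) ∧ ω) vanishes identically, then α = 0. -/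
theorem sum_perm_fin_succ {M : Type*} [AddCommMonoid M] {n : ℕ}
    (f : Equiv.Perm (Fin (n + 1)) → M) :
    ∑ σ, f σ = ∑ p, ∑ e, f (Equiv.Perm.decomposeFin.symm (p, e)) := by
  rw [← Fintype.sum_prod_type', ← Equiv.Perm.decomposeFin.symm.sum_comp]

theorem decomposeFin_symm_two {n : ℕ} (p : Fin (n + 3)) (e : Equiv.Perm (Fin (n + 2))) :
    Equiv.Perm.decomposeFin.symm (p, e) 2 = Equiv.swap 0 p (e 1).succ :=
  Equiv.Perm.decomposeFin_symm_apply_succ e p 1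

theorem decomposeFin_symm_three {n : ℕ} (p : Fin (n + 4)) (e : Equiv.Perm (Fin (n + 3))) :
    Equiv.Perm.decomposeFin.symm (p, e) 3 = Equiv.swap 0 p (e 2).succ :=
  Equiv.Perm.decomposeFin_symm_apply_succ e p 2

/-- Let `V` be a real vector space with `dim V > 4`, `ω` a
nondegenerate alternating bilinear form on `V`, and `J : V → V` linear with
`J∘J = −id`. If `α ∈ V*` is such that the alternating 4-form
`α ∧ (α∘J) ∧ ω` — the full (signed) antisymmetrization of
`(x₁,x₂,x₃,x₄) ↦ α(x₁)·α(Jx₂)·ω(x₃,x₄)` — vanishes identically, then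
`α = 0`. -/
theorem cartan_lemma_wedge_vanishing
    (V : Type*) [AddCommGroup V] [Module ℝ V] [FiniteDimensional ℝ V]
    (hdim : 4 < Module.finrank ℝ V)
    (ω : V →ₗ[ℝ] V →ₗ[ℝ] ℝ)
    (hωalt : ∀ x : V, ω x x = 0)
    (hωnd : ∀ x : V, (∀ y : V, ω x y = 0) → x = 0)
    (J : V →ₗ[ℝ] V) (hJ : J ∘ₗ J = -LinearMap.id)
    (α : Module.Dual ℝ V)
    (hwedge : ∀ x : Fin 4 → V,
      ∑ σ : Equiv.Perm (Fin 4),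
        ((Equiv.Perm.sign σ : ℤ) : ℝ) *
          (α (x (σ 0)) * (α (J (x (σ 1))) * ω (x (σ 2)) (x (σ 3)))) = 0) :
    α = 0 := by
  by_contra hα
  obtain ⟨v, hv⟩ : ∃ v, α v ≠ 0 := by
    by_contra! h
    exact hα (LinearMap.ext h)
  have hJJ (x : V) : J (J x) = -x := by
    simpa using LinearMap.congr_fun hJ x
  have hskew (x y : V) : ω x y = -ω y x := by
    have h := hωalt (x + y)
    simp only [map_add, LinearMap.add_apply, hωalt] at h
    linarith
  obtain ⟨x, hx, hx0⟩ : ∃ x ∈ LinearMap.ker (LinearMap.pi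
      ![α, α ∘ₗ J, ω.flip v, ω.flip (J v)]), x ≠ 0 := by
    apply Submodule.exists_mem_ne_zero_of_ne_bot
    apply LinearMap.ker_ne_bot_of_finrank_lt
    simpa using hdim
  rw [LinearMap.mem_ker, funext_iff] at hx
  have hαx : α x = 0 := by simpa using hx 0
  have hβx : α (J x) = 0 := by simpa using hx 1
  have hxv : ω x v = 0 := by simpa using hx 2
  have hxJv : ω x (J v) = 0 := by simpa using hx 3
  have hvx : ω v x = 0 := by rw [hskew, hxv, neg_zero]
  have hJvx : ω (J v) x = 0 := by rw [hskew, hxJv, neg_zero]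
  refine hx0 (hωnd x fun y => ?_)
  have h := hwedge ![v, J v, x, y]
  have key : (α v ^ 2 + α (J v) ^ 2) * ω x y = 0 := by
    simp [sum_perm_fin_succ, Fin.sum_univ_succ, Equiv.Perm.decomposeFin.symm_sign,
      Equiv.swap_apply_def, decomposeFin_symm_two, decomposeFin_symm_three,
      hαx, hβx, hxv, hxJv, hvx, hJvx, hJJ, hskew y x] at h
    linarith
  exact (mul_eq_zero.mp key).resolve_left (by positivity)
end
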